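/- Every polymatroid (E,f) that admits a tensor product with the uniform matroid U_{2,3} satisfies Ingleton's inequality: for all A,B,C,D ⊆ E, f(AB)+f(AC)+f(BC)+f(AD)+f(BD) ≥ f(A)+f(B)+f(ABC)+f(ABD)+f(CD). -/

import Mathlib

theorem stmt_10 {E : Type*} [DecidableEq E]
    (f : Finset E → ℝ) (g : Finset (E × Fin 3) → ℝ)
    (hf0 : f ∅ = 0)
    (hfmono : ∀ S T : Finset E, S ⊆ T → f S ≤ f T)
    (hfsub : ∀ S T : Finset E, f (S ∪ T) + f (S ∩ T) ≤ f S + f T)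
    (hg0 : g ∅ = 0)
    (hgmono : ∀ S T : Finset (E × Fin 3), S ⊆ T → g S ≤ g T)
    (hgsub : ∀ S T : Finset (E × Fin 3), g (S ∪ T) + g (S ∩ T) ≤ g S + g T)
    (htp : ∀ (S : Finset E) (T : Finset (Fin 3)),
      g (S ×ˢ T) = f S * min (T.card : ℝ) 2)
    (A B C D : Finset E) :
    f (A ∪ B) + f (A ∪ C) + f (B ∪ C) + f (A ∪ D) + f (B ∪ D) ≥
      f A + f B + f (A ∪ B ∪ C) + f (A ∪ B ∪ D) + f (C ∪ D) := by
  have gen : ∀ P Q R W : Finset (E × Fin 3), R ⊆ P → R ⊆ Q → W ⊆ P ∪ Q →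
      g W + g R ≤ g P + g Q := by
    intro P Q R W h1 h2 h3
    have := hgmono _ _ h3
    have := hgmono _ _ (Finset.subset_inter h1 h2)
    have := hgsub P Q
    linarith
  have one : ∀ (S : Finset E) (i : Fin 3), g (S ×ˢ {i}) = f S := by
    intro S i
    rw [htp]
    simp
  have two : ∀ (S : Finset E) (i j : Fin 3), i ≠ j → g (S ×ˢ {i, j}) = 2 * f S := by
    intro S i j h
    rw [htp, Finset.card_pair h]
    norm_num
    ring
  have all : ∀ (S : Finset E), g (S ×ˢ Finset.univ) = 2 * f S := by
    intro S
    rw [htp]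
    simp
    norm_num
    ring
  -- independence of different layers
  have ind : ∀ (X Y : Finset E) (i j : Fin 3), i ≠ j →
      f X + f Y ≤ g (X ×ˢ {i} ∪ Y ×ˢ {j}) := by
    intro X Y i j h
    have h1 := gen (X ×ˢ {i} ∪ (X ∪ Y) ×ˢ {j}) ((X ∪ Y) ×ˢ {i}) (X ×ˢ {i}) ((X ∪ Y) ×ˢ {i, j})
      (by intro ⟨x, k⟩; simp; tauto) (by intro ⟨x, k⟩; simp; tauto)
      (by intro ⟨x, k⟩; simp; tauto)
    have h2 := gen (X ×ˢ {i} ∪ Y ×ˢ {j}) ((X ∪ Y) ×ˢ {j}) (Y ×ˢ {j})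
      (X ×ˢ {i} ∪ (X ∪ Y) ×ˢ {j})
      (by intro ⟨x, k⟩; simp; tauto) (by intro ⟨x, k⟩; simp; tauto)
      (by intro ⟨x, k⟩; simp; tauto)
    rw [two _ _ _ h] at h1
    simp only [one] at h1 h2
    linarith
  have up : ∀ (X Y : Finset E) (i j : Fin 3),
      g (X ×ˢ {i} ∪ Y ×ˢ {j}) ≤ f X + f Y := by
    intro X Y i j
    have h1 := gen (X ×ˢ {i}) (Y ×ˢ {j}) ∅ (X ×ˢ {i} ∪ Y ×ˢ {j}) (by simp) (by simp) subset_rfl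
    simp only [one] at h1
    linarith
  -- two layers of `S` span the third one
  have clos : ∀ (S : Finset E) (W : Finset (E × Fin 3)) (i j : Fin 3), i ≠ j →
      S ×ˢ {i, j} ⊆ W → g (W ∪ S ×ˢ Finset.univ) ≤ g W := by
    intro S W i j h hW
    have h1 := gen W (S ×ˢ Finset.univ) (S ×ˢ {i, j}) (W ∪ S ×ˢ Finset.univ) hW
      (Finset.product_subset_product_right (Finset.subset_univ _)) subset_rfl
    rw [two _ _ _ h, all] at h1
    linarith
  have low : ∀ X : Finset E,
      f X + f (A ∪ B) ≤ g (A ×ˢ {0} ∪ B ×ˢ {1} ∪ X ×ˢ {2}) := by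
    intro X
    have c := clos A (A ×ˢ {0} ∪ (A ∪ X) ×ˢ {2}) 0 2 (by decide)
      (by intro ⟨x, k⟩; simp; tauto)
    have u := up A (A ∪ X) 0 2
    have l := ind A X 0 2 (by decide)
    have l2 := ind (A ∪ B) (A ∪ X) 1 2 (by decide)
    have h := gen (A ×ˢ {0} ∪ B ×ˢ {1} ∪ X ×ˢ {2})
      (A ×ˢ {0} ∪ (A ∪ X) ×ˢ {2} ∪ A ×ˢ Finset.univ) (A ×ˢ {0} ∪ X ×ˢ {2})
      ((A ∪ B) ×ˢ {1} ∪ (A ∪ X) ×ˢ {2})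
      (by intro ⟨x, k⟩; simp; tauto) (by intro ⟨x, k⟩; simp; tauto)
      (by intro ⟨x, k⟩; simp; tauto)
    linarith
  have upA : ∀ X : Finset E,
      g (A ×ˢ {0} ∪ B ×ˢ {1} ∪ (A ∪ X) ×ˢ {2}) ≤ f (A ∪ B) + f (A ∪ X) := by
    intro X
    have c := clos A ((A ∪ B) ×ˢ {1} ∪ (A ∪ X) ×ˢ {2}) 1 2 (by decide)
      (by intro ⟨x, k⟩; simp; tauto)
    have u := up (A ∪ B) (A ∪ X) 1 2
    have m := hgmono (A ×ˢ {0} ∪ B ×ˢ {1} ∪ (A ∪ X) ×ˢ {2})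
      ((A ∪ B) ×ˢ {1} ∪ (A ∪ X) ×ˢ {2} ∪ A ×ˢ Finset.univ)
      (by intro ⟨x, k⟩; simp; tauto)
    linarith
  have upB : ∀ X : Finset E,
      g (A ×ˢ {0} ∪ B ×ˢ {1} ∪ (B ∪ X) ×ˢ {2}) ≤ f (A ∪ B) + f (B ∪ X) := by
    intro X
    have c := clos B ((A ∪ B) ×ˢ {0} ∪ (B ∪ X) ×ˢ {2}) 0 2 (by decide)
      (by intro ⟨x, k⟩; simp; tauto)
    have u := up (A ∪ B) (B ∪ X) 0 2
    have m := hgmono (A ×ˢ {0} ∪ B ×ˢ {1} ∪ (B ∪ X) ×ˢ {2})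
      ((A ∪ B) ×ˢ {0} ∪ (B ∪ X) ×ˢ {2} ∪ B ×ˢ Finset.univ)
      (by intro ⟨x, k⟩; simp; tauto)
    linarith
  have key : ∀ X : Finset E, g (A ×ˢ {0} ∪ B ×ˢ {1} ∪ X ×ˢ {2}) + f (A ∪ B ∪ X) ≤
      f (A ∪ B) + f (A ∪ X) + f (B ∪ X) := by
    intro X
    have h := gen (A ×ˢ {0} ∪ B ×ˢ {1} ∪ (A ∪ X) ×ˢ {2})
      (A ×ˢ {0} ∪ B ×ˢ {1} ∪ (B ∪ X) ×ˢ {2}) (A ×ˢ {0} ∪ B ×ˢ {1} ∪ X ×ˢ {2})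
      (A ×ˢ {0} ∪ B ×ˢ {1} ∪ (A ∪ B ∪ X) ×ˢ {2})
      (by intro ⟨x, k⟩; simp; tauto) (by intro ⟨x, k⟩; simp; tauto)
      (by intro ⟨x, k⟩; simp; tauto)
    have := upA X
    have := upB X
    have := low (A ∪ B ∪ X)
    linarith
  have h := gen (A ×ˢ {0} ∪ B ×ˢ {1} ∪ C ×ˢ {2})
    (A ×ˢ {0} ∪ B ×ˢ {1} ∪ D ×ˢ {2}) (A ×ˢ {0} ∪ B ×ˢ {1})
    (A ×ˢ {0} ∪ B ×ˢ {1} ∪ (C ∪ D) ×ˢ {2})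
    (by intro ⟨x, k⟩; simp; tauto) (by intro ⟨x, k⟩; simp; tauto)
    (by intro ⟨x, k⟩; simp; tauto)
  have := ind A B 0 1 (by decide)
  have := low (C ∪ D)
  have := key C
  have := key D
  linarith
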